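/- Given a pushdown automaton with output A and a state q of A, the set S_{A,q} = {(w, m) : (q0, ε, 0) →* (q, w, m') →* (q_f, ε, m) for some m'} is rational, and an automaton recognizing it can be effectively constructed from A. -/

import Mathlib

/-!
Formalization of context-bounded liveness for dynamic networks of concurrent
pushdown systems (DCPS) and VASS with balloons (VASSB).
Global states, stack symbols, places, balloon states etc. are drawn from ℕ;
the finite components of the systems are recorded as `Finset`s.
-/

noncomputable section

namespace CBL

/-! ### Vectors over a finite output alphabet -/

/-- A vector in `ℕ^Λ` (finitely supported, letters drawn from `ℕ`). -/
abbrev Vec : Type := ℕ →₀ ℕ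

def encodeVec (v : Vec) : ℕ := Encodable.encode v.graph.val

/-! ### Pushdown automata with output and rational subsets of `Γ* × ℕ^Λ` -/

/-- Stack action of an edge: `none` is `ε`, `some (false, γ)` pushes `γ`,
`some (true, γ)` pops `γ` (i.e. reads `γ̄`). -/
abbrev PLabel : Type := Option (Bool × ℕ)

/-- A pushdown automaton with output `(Q, Γ, Λ, E, q0, q_f)`. -/
structure PDAO where
  states : Finset ℕ
  alph : Finset ℕ
  out : Finset ℕ
  edges : Finset (ℕ × PLabel × Vec × ℕ)
  q0 : ℕ
  qf : ℕ

/-- A configuration `(q, w, m)` of a pushdown automaton with output. -/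
abbrev PConf : Type := ℕ × List ℕ × Vec

/-- One step of the pushdown automaton with output `A`. -/
def PStep (A : PDAO) (c c' : PConf) : Prop :=
  ∃ e ∈ A.edges, c.1 = e.1 ∧ c'.1 = e.2.2.2 ∧ c'.2.2 = c.2.2 + e.2.2.1 ∧
    (match e.2.1 with
     | none => c'.2.1 = c.2.1
     | some (false, gam) => c'.2.1 = c.2.1 ++ [gam]
     | some (true, gam) => c.2.1 = c'.2.1 ++ [gam])

def PReach (A : PDAO) : PConf → PConf → Prop := Relation.ReflTransGen (PStep A)

/-- `S_{A,q} = {(w, m) : (q0, ε, 0) →* (q, w, m') →* (q_f, ε, m)}`. -/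
def SSet (A : PDAO) (q : ℕ) : Set (List ℕ × Vec) :=
  {wm | ∃ m' : Vec, PReach A (A.q0, [], 0) (q, wm.1, m') ∧
        PReach A (q, wm.1, m') (A.qf, [], wm.2)}

/-- `I_{A,q} = {(w, m) : (q0, ε, 0) →* (q, w, m)}`. -/
def ISet (A : PDAO) (q : ℕ) : Set (List ℕ × Vec) :=
  {wm | PReach A (A.q0, [], 0) (q, wm.1, wm.2)}

/-- A finite automaton over `Γ* × ℕ^Λ`: edges are labelled by pairs
`(u, m) ∈ Γ* × ℕ^Λ`. -/
structure RatAut where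
  states : Finset ℕ
  edges : Finset (ℕ × (List ℕ × Vec) × ℕ)
  q0 : ℕ
  final : Finset ℕ

/-- One step of the automaton: concatenate the word label, add the vector
label. -/
def RStep (B : RatAut) (c c' : ℕ × List ℕ × Vec) : Prop :=
  ∃ e ∈ B.edges, c.1 = e.1 ∧ c'.1 = e.2.2 ∧
    c'.2.1 = c.2.1 ++ e.2.1.1 ∧ c'.2.2 = c.2.2 + e.2.1.2

/-- The set of labels of accepting runs of `B`; a subset of `Γ* × ℕ^Λ` is
rational iff it is of this form. -/
def RLang (B : RatAut) : Set (List ℕ × Vec) :=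
  {wm | ∃ qf ∈ B.final, Relation.ReflTransGen (RStep B) (B.q0, [], 0) (qf, wm.1, wm.2)}

/-- An effective encoding of pushdown automata with output. -/
def encodePDAO (A : PDAO) : ℕ :=
  Encodable.encode (A.states.val, A.alph.val, A.out.val,
    A.edges.val.map (fun e => (e.1, Encodable.encode e.2.1, encodeVec e.2.2.1, e.2.2.2)),
    A.q0, A.qf)

/-- An effective encoding of finite automata over `Γ* × ℕ^Λ`. -/
def encodeRatAut (B : RatAut) : ℕ :=
  Encodable.encode (B.states.val,
    B.edges.val.map (fun e => (e.1, e.2.1.1, encodeVec e.2.1.2, e.2.2)),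
    B.q0, B.final.val)

/-! ### Commutative grammars in binary normal form -/

section Grammar

variable {N M : Type*} [AddCommMonoid M]

/-- A grammar in binary normal form with outputs in a commutative monoid: `nil X` is a rule
`X → ε`, `one X n Y` a rule `X → n Y` and `two X n Y Z` a rule `X → n Y Z`. -/
structure Grammar (N M : Type*) where
  nil : N → Prop
  one : N → M → N → Prop
  two : N → M → N → N → Prop

namespace Grammar

/-- `G.Derives X m`: some derivation tree with root `X` has output `m`. -/
inductive Derives (G : Grammar N M) : N → M → Prop
  | nil {X} : G.nil X → Derives G X 0
  | one {X n Y m} : G.one X n Y → Derives G Y m → Derives G X (n + m)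
  | two {X n Y Z m m'} : G.two X n Y Z → Derives G Y m → Derives G Z m' →
      Derives G X (n + (m + m'))

/-- `G.DerivesDim k X m`: some derivation tree with root `X`, output `m` and dimension
(Horton–Strahler number) at most `k` exists. -/
inductive DerivesDim (G : Grammar N M) : ℕ → N → M → Prop
  | nil {k X} : G.nil X → DerivesDim G k X 0
  | one {k X n Y m} : G.one X n Y → DerivesDim G k Y m → DerivesDim G k X (n + m)
  | left {k X n Y Z m m'} : G.two X n Y Z → DerivesDim G k Y m → DerivesDim G (k + 1) Z m' →
      DerivesDim G (k + 1) X (n + (m + m'))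
  | right {k X n Y Z m m'} : G.two X n Y Z → DerivesDim G (k + 1) Y m → DerivesDim G k Z m' →
      DerivesDim G (k + 1) X (n + (m + m'))

theorem DerivesDim.succ {G : Grammar N M} {k : ℕ} {X : N} {m : M} (h : G.DerivesDim k X m) :
    G.DerivesDim (k + 1) X m := by
  induction h with
  | nil h => exact .nil h
  | one h _ ih => exact .one h ih
  | left h _ _ ih₁ ih₂ => exact .left h ih₁ ih₂
  | right h _ _ ih₁ ih₂ => exact .right h ih₁ ih₂

theorem DerivesDim.mono {G : Grammar N M} {k l : ℕ} (hkl : k ≤ l) {X : N} {m : M}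
    (h : G.DerivesDim k X m) : G.DerivesDim l X m := by
  induction hkl with
  | refl => exact h
  | step _ ih => exact ih.succ

variable [DecidableEq N]

/-- `G.Tree s V X m`: some derivation tree with root `X` and output `m` has `s` nodes, labelled
by exactly the nonterminals in `V`. -/
inductive Tree (G : Grammar N M) : ℕ → Finset N → N → M → Prop
  | nil {X} : G.nil X → Tree G 1 {X} X 0
  | one {s V X n Y m} : G.one X n Y → Tree G s V Y m → Tree G (s + 1) (insert X V) X (n + m)
  | two {s V s' V' X n Y Z m m'} : G.two X n Y Z → Tree G s V Y m → Tree G s' V' Z m' →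
      Tree G (s + s' + 1) (insert X (V ∪ V')) X (n + (m + m'))

/-- `G.Context s V X B m`: a derivation tree with root `X` and output `m` with one subtree with
root `B` removed, whose remaining `s` nodes are labelled by the nonterminals in `V`. -/
inductive Context (G : Grammar N M) : ℕ → Finset N → N → N → M → Prop
  | hole {X} : Context G 0 ∅ X X 0
  | one {s V X n Y B m} : G.one X n Y → Context G s V Y B m →
      Context G (s + 1) (insert X V) X B (n + m)
  | left {s V s' V' X n Y Z B m m'} : G.two X n Y Z → Context G s V Y B m → Tree G s' V' Z m' →
      Context G (s + s' + 1) (insert X (V ∪ V')) X B (n + (m + m'))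
  | right {s V s' V' X n Y Z B m m'} : G.two X n Y Z → Tree G s V Y m → Context G s' V' Z B m' →
      Context G (s + s' + 1) (insert X (V ∪ V')) X B (n + (m + m'))

variable {G : Grammar N M}

theorem Derives.exists_tree {X : N} {m : M} (h : G.Derives X m) : ∃ s V, G.Tree s V X m := by
  induction h with
  | nil h => exact ⟨_, _, .nil h⟩
  | one h _ ih =>
    obtain ⟨_, _, ih⟩ := ih
    exact ⟨_, _, .one h ih⟩
  | two h _ _ ih₁ ih₂ =>
    obtain ⟨_, _, ih₁⟩ := ih₁
    obtain ⟨_, _, ih₂⟩ := ih₂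
    exact ⟨_, _, .two h ih₁ ih₂⟩

theorem Tree.root_mem {s : ℕ} {V : Finset N} {X : N} {m : M} (h : G.Tree s V X m) : X ∈ V := by
  cases h <;> simp

theorem Context.plug {s s' : ℕ} {V V' : Finset N} {X B : N} {m m' : M}
    (h : G.Context s V X B m) (h' : G.Tree s' V' B m') :
    G.Tree (s + s') (V ∪ V') X (m + m') := by
  induction h with
  | hole => simpa using h'
  | one h _ ih => convert Tree.one h (ih h') using 1 <;> first | omega | simp | abel
  | left h _ t ih =>
    convert Tree.two h (ih h') t using 1
    · omega
    · grind
    · abel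
  | right h t _ ih =>
    convert Tree.two h t (ih h') using 1
    · omega
    · grind
    · abel

theorem Tree.split {s : ℕ} {V : Finset N} {X B : N} {m : M} (h : G.Tree s V X m) (hB : B ∈ V) :
    ∃ s₁ V₁ m₁ s₂ V₂ m₂, G.Context s₁ V₁ X B m₁ ∧ G.Tree s₂ V₂ B m₂ ∧
      s = s₁ + s₂ ∧ V = V₁ ∪ V₂ ∧ m = m₁ + m₂ := by
  by_cases hX : B = X
  · subst hX
    exact ⟨0, ∅, 0, s, V, m, .hole, h, by simp, by simp, by simp⟩
  induction h with
  | nil h => simp_all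
  | @one s V X n Y m h t ih =>
    by_cases hY : B = Y
    · subst hY
      exact ⟨_, _, _, _, _, _, .one h .hole, t, by omega, by grind, by abel⟩
    · obtain ⟨s₁, V₁, m₁, s₂, V₂, m₂, hc, ht, rfl, rfl, rfl⟩ := ih (by simp_all) hY
      exact ⟨_, _, _, _, _, _, .one h hc, ht, by omega, by grind, by abel⟩
  | @two s V s' V' X n Y Z m m' h t t' ih ih' =>
    rcases Finset.mem_union.1 (Finset.mem_of_mem_insert_of_ne hB hX) with hV | hV
    · by_cases hY : B = Y
      · subst hY
        exact ⟨_, _, _, _, _, _, .left h .hole t', t, by omega, by grind, by abel⟩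
      · obtain ⟨s₁, V₁, m₁, s₂, V₂, m₂, hc, ht, rfl, rfl, rfl⟩ := ih hV hY
        exact ⟨_, _, _, _, _, _, .left h hc t', ht, by omega, by grind, by abel⟩
    · by_cases hY : B = Z
      · subst hY
        exact ⟨_, _, _, _, _, _, .right h t .hole, t', by omega, by grind, by abel⟩
      · obtain ⟨s₁, V₁, m₁, s₂, V₂, m₂, hc, ht, rfl, rfl, rfl⟩ := ih' hV hY
        exact ⟨_, _, _, _, _, _, .right h t hc, ht, by omega, by grind, by abel⟩

theorem Tree.insert_pump {s s' : ℕ} {V V' : Finset N} {X B : N} {m m' : M} (h : G.Tree s V X m)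
    (hp : G.Context s' V' B B m') (hB : B ∈ V) : G.Tree (s + s') (V ∪ V') X (m + m') := by
  obtain ⟨s₁, V₁, m₁, s₂, V₂, m₂, hc, ht, rfl, rfl, rfl⟩ := h.split hB
  convert hc.plug (hp.plug ht) using 1
  · omega
  · grind
  · abel

/-- Either no path of a tree repeats a nonterminal, so that its dimension is small, or a
nontrivial pump can be removed from it. -/
theorem Tree.derivesDim_or_pump {s : ℕ} {V : Finset N} {X : N} {m : M} (h : G.Tree s V X m) :
    G.DerivesDim (V.card - 1) X m ∨
      ∃ s₁ V₁ m₁ s₂ V₂ m₂ B, G.Tree s₁ V₁ X m₁ ∧ G.Context s₂ V₂ B B m₂ ∧ 0 < s₂ ∧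
        s = s₁ + s₂ ∧ m = m₁ + m₂ ∧ V₁ ⊆ V ∧ V₂ ⊆ V ∧ B ∈ V := by
  induction h with
  | nil h => exact .inl (.nil h)
  | @one s V X n Y m h t ih =>
    by_cases hX : X ∈ V
    · obtain ⟨s₁, V₁, m₁, s₂, V₂, m₂, hc, ht, rfl, rfl, rfl⟩ := t.split hX
      exact .inr ⟨_, _, _, _, _, _, _, ht, .one h hc, by omega, by omega, by abel, by grind,
        by grind, by grind⟩
    rcases ih with ih | ⟨s₁, V₁, m₁, s₂, V₂, m₂, B, ht, hc, hs, rfl, rfl, h₁, h₂, hB⟩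
    · exact .inl (.one h (ih.mono (by grind)))
    · exact .inr ⟨_, _, _, _, _, _, _, .one h ht, hc, hs, by omega, by abel, by grind, by grind,
        by grind⟩
  | @two s V s' V' X n Y Z m m' h t t' ih ih' =>
    by_cases hX : X ∈ V
    · obtain ⟨s₁, V₁, m₁, s₂, V₂, m₂, hc, ht, rfl, rfl, rfl⟩ := t.split hX
      exact .inr ⟨_, _, _, _, _, _, _, ht, .left h hc t', by omega, by omega, by abel, by grind,
        by grind, by grind⟩
    by_cases hX' : X ∈ V'
    · obtain ⟨s₁, V₁, m₁, s₂, V₂, m₂, hc, ht, rfl, rfl, rfl⟩ := t'.split hX'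
      exact .inr ⟨_, _, _, _, _, _, _, ht, .right h t hc, by omega, by omega, by abel, by grind,
        by grind, by grind⟩
    rcases ih with ih | ⟨s₁, V₁, m₁, s₂, V₂, m₂, B, ht, hc, hs, rfl, rfl, h₁, h₂, hB⟩
    · rcases ih' with ih' | ⟨s₁, V₁, m₁, s₂, V₂, m₂, B, ht, hc, hs, rfl, rfl, h₁, h₂, hB⟩
      · left
        have hXU : X ∉ V ∪ V' := by simp [hX, hX']
        have hV := Finset.card_le_card (Finset.subset_union_left (s₁ := V) (s₂ := V'))
        have hV' := Finset.card_le_card (Finset.subset_union_right (s₁ := V) (s₂ := V'))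
        have hpos := Finset.card_pos.2 ⟨_, t.root_mem⟩
        rw [Finset.card_insert_of_notMem hXU, Nat.add_sub_cancel]
        obtain ⟨k, hk⟩ : ∃ k, (V ∪ V').card = k + 1 := ⟨(V ∪ V').card - 1, by omega⟩
        rw [hk]
        exact .left h (ih.mono (by omega)) (ih'.mono (by omega))
      · exact .inr ⟨_, _, _, _, _, _, _, .two h t ht, hc, hs, by omega, by abel, by grind,
          by grind, by grind⟩
    · exact .inr ⟨_, _, _, _, _, _, _, .two h ht t', hc, hs, by omega, by abel, by grind,
        by grind, by grind⟩

/-- The output of a tree is the output of a tree whose dimension is at most the number of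
nonterminals: this is Parikh's theorem in the form of Esparza, Ganty, Kiefer and Luttenberger. -/
theorem Tree.derivesDim_card {s : ℕ} {V : Finset N} {X : N} {m : M} (h : G.Tree s V X m) :
    G.DerivesDim V.card X m := by
  induction s using Nat.strong_induction_on generalizing V X m with
  | _ s ih =>
  cases h with
  | nil h => exact .nil h
  | one h t => exact .one h ((ih _ (by omega) t).mono (Finset.card_le_card (by grind)))
  | @two s₁ V₁ s₂ V₂ _ n Y Z m₁ m₂ h t₁ t₂ =>
    set W := insert X (V₁ ∪ V₂) with hW
    have hXW : X ∈ W := by simp [hW]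
    have hsub₁ : V₁ ⊆ W := by grind
    have hsub₂ : V₂ ⊆ W := by grind
    clear_value W
    obtain ⟨k, hk⟩ : ∃ k, W.card = k + 1 :=
      ⟨W.card - 1, by have := Finset.card_pos.2 ⟨_, hXW⟩; omega⟩
    have small {s' V' U m'} (ht : G.Tree s' V' U m') (hs : s' < s₁ + s₂ + 1) (hV : V' ⊆ W)
        (hne : V' ≠ W) : G.DerivesDim k U m' :=
      (ih _ hs ht).mono (by
        have := Finset.card_lt_card (lt_of_le_of_ne hV hne)
        omega)
    have any {s' V' U m'} (ht : G.Tree s' V' U m') (hs : s' < s₁ + s₂ + 1) (hV : V' ⊆ W) :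
        G.DerivesDim (k + 1) U m' :=
      (ih _ hs ht).mono (hk ▸ Finset.card_le_card hV)
    rw [hk]
    by_cases hV₂ : V₂ = W
    · subst hV₂
      clear hW
      generalize hs : s₁ + s₂ + 1 = s at ih small any
      induction s₁ using Nat.strong_induction_on generalizing V₁ s₂ m₁ m₂ with
      | _ s₁ ih₁ =>
      rcases t₁.derivesDim_or_pump with
        hd | ⟨r₁, U₁, l₁, r₂, U₂, l₂, B, ht, hc, hr, rfl, rfl, h₁, h₂, hB⟩
      · by_cases hV₁ : V₁ = V₂
        · subst hV₁
          exact .left h (hd.mono (by omega)) (any t₂ (by omega) hsub₂)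
        · exact .left h (small t₁ (by omega) hsub₁ hV₁) (any t₂ (by omega) hsub₂)
      · have t₂' := t₂.insert_pump hc (hsub₁ hB)
        rw [Finset.union_eq_left.2 (h₂.trans hsub₁)] at t₂'
        convert ih₁ r₁ (by omega) ht t₂' (h₁.trans hsub₁) (by omega) using 1
        abel
    · exact .right h (any t₁ (by omega) hsub₁) (small t₂ (by omega) hsub₂ hV₂)

end Grammar

end Grammar

/-! ### The grammar of level runs of a pushdown automaton -/

/-- A nonterminal `(0, p, r)` stands for the runs from `p` to `r` that leave the stack unchanged,
a nonterminal `(γ + 1, p, r)` for the runs from `p` to `r` that pop one `γ`. -/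
abbrev Item : Type := ℕ × ℕ × ℕ

/-- The grammar generating the outputs of the runs described by items, for states up to `b`. -/
def levelGrammar (A : PDAO) (b : ℕ) : Grammar Item Vec where
  nil X := ∃ p ≤ b, X = (0, p, p)
  one X n Y := ∃ l p p' r, (p, l, n, p') ∈ A.edges ∧ X = (0, p, r) ∧
    (l = none ∧ Y = (0, p', r) ∨ ∃ γ, l = some (false, γ) ∧ Y = (γ + 1, p', r))
  two X n Y Z := ∃ γ p s s' r, (s, some (true, γ), n, s') ∈ A.edges ∧ X = (γ + 1, p, r) ∧
    Y = (0, p, s) ∧ Z = (0, s', r)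

/-- All states and stack symbols of `A` are bounded by `b`. -/
structure PDAO.Bounded (A : PDAO) (b : ℕ) : Prop where
  q0 : A.q0 ≤ b
  qf : A.qf ≤ b
  src : ∀ p l n p', (p, l, n, p') ∈ A.edges → p ≤ b
  tgt : ∀ p l n p', (p, l, n, p') ∈ A.edges → p' ≤ b
  symb : ∀ p x γ n p', (p, some (x, γ), n, p') ∈ A.edges → γ + 1 ≤ b
  vec : ∀ p l n p', (p, l, n, p') ∈ A.edges → encodeVec n ≤ b

/-- All components of an item are at most `b`. -/
def Item.Le (X : Item) (b : ℕ) : Prop := X.1 ≤ b ∧ X.2.1 ≤ b ∧ X.2.2 ≤ b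

section Level

variable {A : PDAO} {b : ℕ}

theorem derives_refl {p : ℕ} (hp : p ≤ b) : (levelGrammar A b).Derives (0, p, p) 0 :=
  .nil ⟨p, hp, rfl⟩

theorem Derives.trans {X : Item} {m m' : Vec} {r : ℕ} (h : (levelGrammar A b).Derives X m)
    (h' : (levelGrammar A b).Derives (0, X.2.2, r) m') :
    (levelGrammar A b).Derives (X.1, X.2.1, r) (m + m') := by
  induction h with
  | nil h =>
    obtain ⟨p, -, rfl⟩ := h
    simpa using h'
  | one h _ ih =>
    obtain ⟨l, p, p', s, he, rfl, ⟨rfl, rfl⟩ | ⟨γ, rfl, rfl⟩⟩ := h <;> rw [add_assoc]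
    · exact .one ⟨_, _, _, _, he, rfl, .inl ⟨rfl, rfl⟩⟩ (ih h')
    · exact .one ⟨_, _, _, _, he, rfl, .inr ⟨_, rfl, rfl⟩⟩ (ih h')
  | two h h₁ _ _ ih =>
    obtain ⟨γ, p, s, s', t, he, rfl, rfl, rfl⟩ := h
    rw [add_assoc, add_assoc]
    exact .two ⟨_, _, _, _, _, he, rfl, rfl, rfl⟩ h₁ (ih h')

theorem derives_eps (hA : A.Bounded b) {p p' : ℕ} {n : Vec} (he : (p, none, n, p') ∈ A.edges) :
    (levelGrammar A b).Derives (0, p, p') n := by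
  simpa using Grammar.Derives.one (G := levelGrammar A b) ⟨_, _, _, _, he, rfl, .inl ⟨rfl, rfl⟩⟩
    (derives_refl (hA.tgt _ _ _ _ he))

theorem derives_push_pop (hA : A.Bounded b) {p p' s s' γ : ℕ} {n n' m : Vec}
    (he : (p, some (false, γ), n, p') ∈ A.edges) (h : (levelGrammar A b).Derives (0, p', s) m)
    (he' : (s, some (true, γ), n', s') ∈ A.edges) :
    (levelGrammar A b).Derives (0, p, s') (n + (n' + m)) := by
  simpa using Grammar.Derives.one (G := levelGrammar A b)
    ⟨_, _, _, _, he, rfl, .inr ⟨_, rfl, rfl⟩⟩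
    (.two ⟨_, _, _, _, _, he', rfl, rfl, rfl⟩ h (derives_refl (hA.tgt _ _ _ _ he')))

theorem levelGrammar_nil_le {X : Item} (h : (levelGrammar A b).nil X) : X.Le b := by
  obtain ⟨p, hp, rfl⟩ := h
  exact ⟨by simp, hp, hp⟩

theorem levelGrammar_one_le (hA : A.Bounded b) {X Y : Item} {n : Vec}
    (h : (levelGrammar A b).one X n Y) (hY : Y.Le b) : X.Le b := by
  obtain ⟨l, p, p', r, he, rfl, ⟨rfl, rfl⟩ | ⟨γ, rfl, rfl⟩⟩ := h <;>
  exact ⟨by simp, hA.src _ _ _ _ he, hY.2.2⟩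

theorem levelGrammar_two_le (hA : A.Bounded b) {X Y Z : Item} {n : Vec}
    (h : (levelGrammar A b).two X n Y Z) (hY : Y.Le b) (hZ : Z.Le b) : X.Le b := by
  obtain ⟨γ, p, s, s', r, he, rfl, rfl, rfl⟩ := h
  exact ⟨hA.symb _ _ _ _ _ he, hY.2.1, hZ.2.2⟩

theorem Derives.le (hA : A.Bounded b) {X : Item} {m : Vec}
    (h : (levelGrammar A b).Derives X m) : X.Le b := by
  induction h with
  | nil h => exact levelGrammar_nil_le h
  | one h _ ih => exact levelGrammar_one_le hA h ih
  | two h _ _ ih₁ ih₂ => exact levelGrammar_two_le hA h ih₁ ih₂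

theorem DerivesDim.le (hA : A.Bounded b) {k : ℕ} {X : Item} {m : Vec}
    (h : (levelGrammar A b).DerivesDim k X m) : X.Le b := by
  induction h with
  | nil h => exact levelGrammar_nil_le h
  | one h _ ih => exact levelGrammar_one_le hA h ih
  | left h _ _ ih₁ ih₂ => exact levelGrammar_two_le hA h ih₁ ih₂
  | right h _ _ ih₁ ih₂ => exact levelGrammar_two_le hA h ih₁ ih₂

theorem Tree.le (hA : A.Bounded b) {s : ℕ} {V : Finset Item} {X : Item} {m : Vec}
    (h : (levelGrammar A b).Tree s V X m) : ∀ Y ∈ V, Y.Le b := by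
  induction h with
  | nil h => simpa using levelGrammar_nil_le h
  | one h t ih =>
    exact Finset.forall_mem_insert _ _ _ |>.2 ⟨levelGrammar_one_le hA h (ih _ t.root_mem), ih⟩
  | two h t t' ih ih' =>
    refine Finset.forall_mem_insert _ _ _ |>.2
      ⟨levelGrammar_two_le hA h (ih _ t.root_mem) (ih' _ t'.root_mem), fun Y hY => ?_⟩
    exact (Finset.mem_union.1 hY).elim (ih Y) (ih' Y)

/-- Every level run has the output of a derivation of bounded dimension. -/
theorem Derives.derivesDim (hA : A.Bounded b) {X : Item} {m : Vec}
    (h : (levelGrammar A b).Derives X m) : (levelGrammar A b).DerivesDim ((b + 1) ^ 3) X m := by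
  obtain ⟨s, V, t⟩ := h.exists_tree
  refine t.derivesDim_card.mono ?_
  have hV : V ⊆ Finset.range (b + 1) ×ˢ (Finset.range (b + 1) ×ˢ Finset.range (b + 1)) := by
    intro Y hY
    obtain ⟨h₁, h₂, h₃⟩ := Tree.le hA t Y hY
    simp only [Finset.mem_product, Finset.mem_range]
    omega
  refine (Finset.card_le_card hV).trans_eq ?_
  simp only [Finset.card_product, Finset.card_range]
  ring

/-! ### Decomposition of runs -/

/-- `Ascent A b p v q m`: a run from `p` with empty stack to `q` with stack `v` (top first) and
output `m`, decomposed into level runs and the last push of every stack symbol. -/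
def Ascent (A : PDAO) (b p : ℕ) : List ℕ → ℕ → Vec → Prop
  | [], q, m => (levelGrammar A b).Derives (0, p, q) m
  | γ :: v, q, m => ∃ s s' m₁ n m₂, Ascent A b p v s m₁ ∧ (s, some (false, γ), n, s') ∈ A.edges ∧
      (levelGrammar A b).Derives (0, s', q) m₂ ∧ m = m₁ + (n + m₂)

/-- `Descent A b r p v m`: a run from `p` with stack `v` (top first) to `r` with empty stack and
output `m`, decomposed into level runs and the pops of the stack symbols. -/
def Descent (A : PDAO) (b r : ℕ) : ℕ → List ℕ → Vec → Prop
  | p, [], m => (levelGrammar A b).Derives (0, p, r) m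
  | p, γ :: v, m => ∃ s s' m₁ n m₂, (levelGrammar A b).Derives (0, p, s) m₁ ∧
      (s, some (true, γ), n, s') ∈ A.edges ∧ Descent A b r s' v m₂ ∧ m = m₁ + (n + m₂)

theorem Ascent.trans {p q q' : ℕ} {v : List ℕ} {m m' : Vec} (h : Ascent A b p v q m)
    (h' : (levelGrammar A b).Derives (0, q, q') m') : Ascent A b p v q' (m + m') := by
  cases v with
  | nil => exact Derives.trans (X := (0, p, q)) h h'
  | cons γ v =>
    obtain ⟨s, s', m₁, n, m₂, h₁, he, h₂, rfl⟩ := h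
    exact ⟨s, s', m₁, n, _, h₁, he, Derives.trans h₂ h', by abel⟩

theorem Descent.trans {p p' r : ℕ} {v : List ℕ} {m m' : Vec}
    (h : (levelGrammar A b).Derives (0, p, p') m) (h' : Descent A b r p' v m') :
    Descent A b r p v (m + m') := by
  cases v with
  | nil => exact Derives.trans (X := (0, p, p')) h h'
  | cons γ v =>
    obtain ⟨s, s', m₁, n, m₂, h₁, he, h₂, rfl⟩ := h'
    exact ⟨s, s', _, n, m₂, Derives.trans (X := (0, p, p')) h h₁, he, h₂, by abel⟩

theorem PReach.ascent (hA : A.Bounded b) {p : ℕ} (hp : p ≤ b) {m₀ : Vec} {c : PConf}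
    (h : PReach A (p, [], m₀) c) :
    ∃ m, Ascent A b p c.2.1.reverse c.1 m ∧ c.2.2 = m₀ + m := by
  induction h with
  | refl => exact ⟨0, derives_refl hp, by simp⟩
  | @tail c c' _ hs ih =>
    obtain ⟨m, hm, hc⟩ := ih
    obtain ⟨q, w, k⟩ := c
    obtain ⟨q', w', k'⟩ := c'
    obtain ⟨⟨p', l, n, p''⟩, he, h₁, h₂, h₃, hl⟩ := hs
    dsimp only at *
    subst h₁ h₂ h₃ hc
    match l, hl with
    | none, hl =>
      subst hl
      exact ⟨_, hm.trans (derives_eps hA he), by abel⟩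
    | some (false, γ), hl =>
      subst hl
      refine ⟨m + (n + 0), ?_, by abel⟩
      rw [List.reverse_append]
      exact ⟨_, _, _, _, _, hm, he, derives_refl (hA.tgt _ _ _ _ he), rfl⟩
    | some (true, γ), hl =>
      subst hl
      rw [List.reverse_append] at hm
      obtain ⟨s, s', m₁, n', m₂, h₁, he', h₂, rfl⟩ := hm
      exact ⟨_, h₁.trans (derives_push_pop hA he' h₂ he), by abel⟩

theorem PReach.descent (hA : A.Bounded b) {r : ℕ} (hr : r ≤ b) {m₁ : Vec} {c : PConf}
    (h : PReach A c (r, [], m₁)) :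
    ∃ m, Descent A b r c.1 c.2.1.reverse m ∧ m₁ = c.2.2 + m := by
  induction h using Relation.ReflTransGen.head_induction_on with
  | refl => exact ⟨0, derives_refl hr, by simp⟩
  | @head c c' hs _ ih =>
    obtain ⟨m, hm, hc⟩ := ih
    obtain ⟨q, w, k⟩ := c
    obtain ⟨q', w', k'⟩ := c'
    obtain ⟨⟨p', l, n, p''⟩, he, h₁, h₂, h₃, hl⟩ := hs
    dsimp only at *
    subst h₁ h₂ h₃ hc
    match l, hl with
    | none, hl =>
      subst hl
      exact ⟨_, .trans (derives_eps hA he) hm, by abel⟩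
    | some (false, γ), hl =>
      subst hl
      rw [List.reverse_append] at hm
      obtain ⟨s, s', m₁, n', m₂, h₁, he', h₂, rfl⟩ := hm
      exact ⟨_, .trans (derives_push_pop hA he h₁ he') h₂, by abel⟩
    | some (true, γ), hl =>
      subst hl
      refine ⟨0 + (n + m), ?_, by abel⟩
      rw [List.reverse_append]
      exact ⟨_, _, _, _, _, derives_refl (hA.src _ _ _ _ he), he, hm, rfl⟩

theorem Ascent.le (hA : A.Bounded b) {p q : ℕ} {v : List ℕ} {m : Vec} (h : Ascent A b p v q m) :
    q ≤ b := by
  cases v with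
  | nil => exact (Derives.le hA h).2.2
  | cons γ v =>
    obtain ⟨s, s', m₁, n, m₂, h₁, he, h₂, rfl⟩ := h
    exact (Derives.le hA h₂).2.2

theorem Descent.le (hA : A.Bounded b) {p r : ℕ} {v : List ℕ} {m : Vec}
    (h : Descent A b r p v m) : p ≤ b := by
  cases v with
  | nil => exact (Derives.le hA h).2.1
  | cons γ v =>
    obtain ⟨s, s', m₁, n, m₂, h₁, he, h₂, rfl⟩ := h
    exact (Derives.le hA h₁).2.1

end Level

/-! ### The automaton recognizing `S_{A,q}` -/

/-- A state consists of a control item and a stack of items whose output is still to be produced.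
The control item `(0, p, r)` records the state `p` of the ascending run and the state `r` of the
descending run at the current stack symbol; a control item `(γ + 1, p, r)` occurs between the
pushing and the popping of `γ`. -/
abbrev CState : Type := Item × List Item

/-- The transitions of the automaton, without a bound on the size of the states. -/
inductive CStep (A : PDAO) : CState → List ℕ → Vec → CState → Prop
  | ascend (p r p') : CStep A ((0, p, r), []) [] 0 ((0, p', r), [(0, p, p')])
  | descend (p r r') : CStep A ((0, p, r), []) [] 0 ((0, p, r'), [(0, r', r)])
  | push {p γ n p'} (r) : (p, some (false, γ), n, p') ∈ A.edges →
      CStep A ((0, p, r), []) [γ] n ((γ + 1, p', r), [])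
  | pop {s γ n s'} (p) : (s, some (true, γ), n, s') ∈ A.edges →
      CStep A ((γ + 1, p, s'), []) [] n ((0, p, s), [])
  | nil (X L p) : CStep A (X, (0, p, p) :: L) [] 0 (X, L)
  | eps {p n p'} (X L r) : (p, none, n, p') ∈ A.edges →
      CStep A (X, (0, p, r) :: L) [] n (X, (0, p', r) :: L)
  | call {p γ n p'} (X L r) : (p, some (false, γ), n, p') ∈ A.edges →
      CStep A (X, (0, p, r) :: L) [] n (X, (γ + 1, p', r) :: L)
  | retLeft {s γ n s'} (X L p r) : (s, some (true, γ), n, s') ∈ A.edges →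
      CStep A (X, (γ + 1, p, r) :: L) [] n (X, (0, p, s) :: (0, s', r) :: L)
  | retRight {s γ n s'} (X L p r) : (s, some (true, γ), n, s') ∈ A.edges →
      CStep A (X, (γ + 1, p, r) :: L) [] n (X, (0, s', r) :: (0, p, s) :: L)

/-- Runs of a labelled transition relation, with their labels. -/
inductive LabelledRun {S : Type*} (T : S → List ℕ → Vec → S → Prop) :
    S → List ℕ → Vec → S → Prop
  | refl {s} : LabelledRun T s [] 0 s
  | head {s u n t u' n' t'} : T s u n t → LabelledRun T t u' n' t' →
      LabelledRun T s (u ++ u') (n + n') t'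

theorem LabelledRun.trans {S : Type*} {T : S → List ℕ → Vec → S → Prop} {s t t' : S}
    {u u' : List ℕ} {n n' : Vec} (h : LabelledRun T s u n t) (h' : LabelledRun T t u' n' t') :
    LabelledRun T s (u ++ u') (n + n') t' := by
  induction h with
  | refl => simpa using h'
  | head h _ ih =>
    rw [List.append_assoc, add_assoc]
    exact .head h (ih h')

theorem LabelledRun.mono {S : Type*} {T T' : S → List ℕ → Vec → S → Prop}
    (hT : ∀ s u n t, T s u n t → T' s u n t) {s t : S} {u : List ℕ} {n : Vec}
    (h : LabelledRun T s u n t) : LabelledRun T' s u n t := by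
  induction h with
  | refl => exact .refl
  | head h _ ih => exact .head (hT _ _ _ _ h) ih

/-! ### Soundness -/

/-- `X.Sound A m`: the runs described by `X` can have output `m`. -/
def Item.Sound (A : PDAO) : Item → Vec → Prop
  | (0, p, r), m => ∀ w m₀, PReach A (p, w, m₀) (r, w, m₀ + m)
  | (γ + 1, p, r), m => ∀ w m₀, PReach A (p, w ++ [γ], m₀) (r, w, m₀ + m)

/-- The items of a stack can together have output `m`. -/
def StackSound (A : PDAO) : List Item → Vec → Prop
  | [], m => m = 0
  | X :: L, m => ∃ m₁ m₂, X.Sound A m₁ ∧ StackSound A L m₂ ∧ m = m₁ + m₂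

/-- From the control item, the ascending run reaches `q` by pushing `u`, and the descending run
pops `u` from `q` on, with total output `m`. -/
def ControlSound (A : PDAO) (q : ℕ) : Item → List ℕ → Vec → Prop
  | (0, p, r), u, m => ∃ m₁ m₂, m = m₁ + m₂ ∧ ∀ w m₀, PReach A (p, w, m₀) (q, w ++ u, m₀ + m₁) ∧
      PReach A (q, w ++ u, m₀) (r, w, m₀ + m₂)
  | (γ + 1, p, r), u, m => ∃ m₁ m₂, m = m₁ + m₂ ∧ ∀ w m₀,
      PReach A (p, w, m₀) (q, w ++ u, m₀ + m₁) ∧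
      PReach A (q, w ++ γ :: u, m₀) (r, w, m₀ + m₂)

section Soundness

variable {A : PDAO} {q : ℕ}

theorem pReach_eps {p p' : ℕ} {n : Vec} (h : (p, none, n, p') ∈ A.edges) (w : List ℕ)
    (m₀ : Vec) : PReach A (p, w, m₀) (p', w, m₀ + n) :=
  .single ⟨_, h, rfl, rfl, rfl, rfl⟩

theorem pReach_push {p p' γ : ℕ} {n : Vec} (h : (p, some (false, γ), n, p') ∈ A.edges)
    (w : List ℕ) (m₀ : Vec) : PReach A (p, w, m₀) (p', w ++ [γ], m₀ + n) :=
  .single ⟨_, h, rfl, rfl, rfl, rfl⟩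

theorem pReach_pop {p p' γ : ℕ} {n : Vec} (h : (p, some (true, γ), n, p') ∈ A.edges)
    (w : List ℕ) (m₀ : Vec) : PReach A (p, w ++ [γ], m₀) (p', w, m₀ + n) :=
  .single ⟨_, h, rfl, rfl, rfl, rfl⟩

theorem sound_ret {p r s s' γ : ℕ} {n m₁ m₂ : Vec} (he : (s, some (true, γ), n, s') ∈ A.edges)
    (h₁ : Item.Sound A (0, p, s) m₁) (h₂ : Item.Sound A (0, s', r) m₂) :
    Item.Sound A (γ + 1, p, r) (n + (m₁ + m₂)) := by
  intro w m₀
  have := ((h₁ (w ++ [γ]) m₀).trans (pReach_pop he _ _)).trans (h₂ w _)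
  rwa [show m₀ + m₁ + n + m₂ = m₀ + (n + (m₁ + m₂)) by abel] at this

theorem CStep.sound {s t : CState} {u u' : List ℕ} {n : Vec} (h : CStep A s u n t)
    {m₁ m₂ : Vec} (h₁ : StackSound A t.2 m₁) (h₂ : ControlSound A q t.1 u' m₂) :
    ∃ m₁' m₂', n + (m₁ + m₂) = m₁' + m₂' ∧ StackSound A s.2 m₁' ∧
      ControlSound A q s.1 (u ++ u') m₂' := by
  cases h with
  | ascend p r p' =>
    obtain ⟨k, _, hk, rfl, rfl⟩ := h₁
    obtain ⟨l₁, l₂, rfl, hl⟩ := h₂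
    refine ⟨0, (k + l₁) + l₂, by abel, rfl, _, _, rfl, fun w m₀ => ⟨?_, (hl w m₀).2⟩⟩
    rw [← add_assoc]
    exact (hk w m₀).trans (hl w _).1
  | descend p r r' =>
    obtain ⟨k, _, hk, rfl, rfl⟩ := h₁
    obtain ⟨l₁, l₂, rfl, hl⟩ := h₂
    refine ⟨0, l₁ + (l₂ + k), by abel, rfl, _, _, rfl, fun w m₀ => ⟨(hl w m₀).1, ?_⟩⟩
    rw [← add_assoc]
    exact (hl w _).2.trans (hk w _)
  | @push p γ n p' r he =>
    obtain rfl := h₁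
    obtain ⟨l₁, l₂, rfl, hl⟩ := h₂
    refine ⟨0, (n + l₁) + l₂, by abel, rfl, _, _, rfl, fun w m₀ => ⟨?_, ?_⟩⟩
    · have := (pReach_push he w m₀).trans (hl _ _).1
      rwa [List.append_assoc, add_assoc] at this
    · exact (hl w m₀).2
  | @pop s γ n s' p he =>
    obtain rfl := h₁
    obtain ⟨l₁, l₂, rfl, hl⟩ := h₂
    refine ⟨0, l₁ + (l₂ + n), by abel, rfl, _, _, rfl, fun w m₀ => ⟨(hl w m₀).1, ?_⟩⟩
    have := (hl (w ++ [γ]) m₀).2.trans (pReach_pop he _ _)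
    rwa [List.append_assoc, add_assoc] at this
  | nil X L p =>
    exact ⟨m₁, m₂, by abel, ⟨0, m₁, fun w m₀ => by rw [add_zero]; exact .refl, h₁, by abel⟩, h₂⟩
  | eps X L r he =>
    obtain ⟨k₁, k₂, hk, hL, rfl⟩ := h₁
    refine ⟨_, m₂, by rw [← add_assoc], ⟨_, k₂, fun w m₀ => ?_, hL, by rw [← add_assoc]⟩, h₂⟩
    rw [← add_assoc]
    exact (pReach_eps he w m₀).trans (hk w _)
  | call X L r he =>
    obtain ⟨k₁, k₂, hk, hL, rfl⟩ := h₁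
    refine ⟨_, m₂, by rw [← add_assoc], ⟨_, k₂, fun w m₀ => ?_, hL, by rw [← add_assoc]⟩, h₂⟩
    rw [← add_assoc]
    exact (pReach_push he w m₀).trans (hk w _)
  | retLeft X L p r he =>
    obtain ⟨k₁, _, hk₁, ⟨k₂, k₃, hk₂, hL, rfl⟩, rfl⟩ := h₁
    exact ⟨_, m₂, by rw [← add_assoc], ⟨_, k₃, sound_ret he hk₁ hk₂, hL, by abel⟩, h₂⟩
  | retRight X L p r he =>
    obtain ⟨k₁, _, hk₁, ⟨k₂, k₃, hk₂, hL, rfl⟩, rfl⟩ := h₁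
    exact ⟨_, m₂, by rw [← add_assoc], ⟨_, k₃, sound_ret he hk₂ hk₁, hL, by abel⟩, h₂⟩

theorem LabelledRun.sound {s t : CState} {u u' : List ℕ} {n : Vec}
    (h : LabelledRun (CStep A) s u n t) {m₁ m₂ : Vec} (h₁ : StackSound A t.2 m₁)
    (h₂ : ControlSound A q t.1 u' m₂) :
    ∃ m₁' m₂', n + (m₁ + m₂) = m₁' + m₂' ∧ StackSound A s.2 m₁' ∧
      ControlSound A q s.1 (u ++ u') m₂' := by
  induction h with
  | refl => exact ⟨m₁, m₂, by abel, h₁, h₂⟩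
  | head h _ ih =>
    obtain ⟨k₁, k₂, hk, h₁', h₂'⟩ := ih h₁ h₂
    rw [List.append_assoc, add_assoc, hk]
    exact h.sound h₁' h₂'

theorem mem_SSet_of_labelledRun {w : List ℕ} {m : Vec}
    (h : LabelledRun (CStep A) ((0, A.q0, A.qf), []) w m ((0, q, q), [])) :
    (w, m) ∈ SSet A q := by
  have hq : ControlSound A q (0, q, q) [] 0 :=
    ⟨0, 0, by simp, fun w m₀ => by
      simp only [List.append_nil, add_zero]
      exact ⟨.refl, .refl⟩⟩
  obtain ⟨_, _, hm, rfl, k₁, k₂, rfl, hk⟩ := h.sound (m₁ := 0) rfl hq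
  obtain ⟨h₁, -⟩ := hk [] 0
  obtain ⟨-, h₂⟩ := hk [] k₁
  simp only [List.nil_append, List.append_nil, zero_add, add_zero] at hm h₁ h₂
  subst hm
  exact ⟨k₁, h₁, h₂⟩

end Soundness

/-! ### Completeness for a bounded number of states -/

/-- The states with at most `K` stack items, all of whose components are at most `b`. -/
def CState.Le (s : CState) (b K : ℕ) : Prop :=
  s.1.Le b ∧ (∀ X ∈ s.2, X.Le b) ∧ s.2.length ≤ K

/-- The transitions of the automaton between states of bounded size. -/
def BoundedStep (A : PDAO) (b K : ℕ) (s : CState) (u : List ℕ) (n : Vec) (t : CState) : Prop :=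
  CStep A s u n t ∧ s.Le b K ∧ t.Le b K

section Completeness

variable {A : PDAO} {b K : ℕ}

theorem LabelledRun.cons_nil {S : Type*} {T : S → List ℕ → Vec → S → Prop} {s t t' : S}
    {u : List ℕ} {n n' : Vec} (h : T s [] n t) (h' : LabelledRun T t u n' t') :
    LabelledRun T s u (n + n') t' :=
  .head h h'

theorem DerivesDim.labelledRun (hA : A.Bounded b) {k : ℕ} {X : Item} {m : Vec}
    (h : (levelGrammar A b).DerivesDim k X m) {Y : Item} {L : List Item} (hY : Y.Le b)
    (hL : ∀ Z ∈ L, Z.Le b) (hK : L.length + k + 1 ≤ K) :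
    LabelledRun (BoundedStep A b K) (Y, X :: L) [] m (Y, L) := by
  have bounded {L' : List Item} (h₁ : ∀ Z ∈ L', Z.Le b) (h₂ : L'.length ≤ K) :
      CState.Le (Y, L') b K := ⟨hY, h₁, h₂⟩
  induction h generalizing L with
  | nil h =>
    have hX := levelGrammar_nil_le h
    obtain ⟨p, hp, rfl⟩ := h
    have step : BoundedStep A b K (Y, (0, p, p) :: L) [] 0 (Y, L) :=
      ⟨.nil _ _ _, bounded (by simp; tauto) (by simp; omega), bounded hL (by omega)⟩
    simpa using LabelledRun.cons_nil step .refl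
  | one h t ih =>
    have hZ := DerivesDim.le hA t
    have hX := levelGrammar_one_le hA h hZ
    obtain ⟨l, p, p', s, he, rfl, ⟨rfl, rfl⟩ | ⟨γ, rfl, rfl⟩⟩ := h
    · exact .cons_nil ⟨.eps _ _ _ he, bounded (by simp; tauto) (by simp; omega),
        bounded (by simp; tauto) (by simp; omega)⟩ (ih hL hK)
    · exact .cons_nil ⟨.call _ _ _ he, bounded (by simp; tauto) (by simp; omega),
        bounded (by simp; tauto) (by simp; omega)⟩ (ih hL hK)
  | left h t t' ih ih' =>
    have hZ := DerivesDim.le hA t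
    have hZ' := DerivesDim.le hA t'
    have hX := levelGrammar_two_le hA h hZ hZ'
    obtain ⟨γ, p, s, s', r, he, rfl, rfl, rfl⟩ := h
    exact .cons_nil ⟨.retLeft _ _ _ _ he, bounded (by simp; tauto) (by simp; omega),
      bounded (by simp; tauto) (by simp; omega)⟩
      ((ih (by simp; tauto) (by simp; omega)).trans (ih' hL hK))
  | right h t t' ih ih' =>
    have hZ := DerivesDim.le hA t
    have hZ' := DerivesDim.le hA t'
    have hX := levelGrammar_two_le hA h hZ hZ'
    obtain ⟨γ, p, s, s', r, he, rfl, rfl, rfl⟩ := h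
    rename_i m m'
    rw [add_comm m m']
    exact .cons_nil ⟨.retRight _ _ _ _ he, bounded (by simp; tauto) (by simp; omega),
      bounded (by simp; tauto) (by simp; omega)⟩
      ((ih' (by simp; tauto) (by simp; omega)).trans (ih hL hK))

theorem labelledRun_ascend (hA : A.Bounded b) (hK : (b + 1) ^ 3 + 1 ≤ K) {p p' r : ℕ} {m : Vec}
    (hr : r ≤ b) (h : (levelGrammar A b).Derives (0, p, p') m) :
    LabelledRun (BoundedStep A b K) ((0, p, r), []) [] m ((0, p', r), []) := by
  have hX := Derives.le hA h
  have hY : Item.Le (0, p', r) b := ⟨hX.1, hX.2.2, hr⟩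
  rw [← zero_add m]
  exact .cons_nil ⟨.ascend _ _ _, ⟨⟨hX.1, hX.2.1, hr⟩, by simp, by simp⟩,
    ⟨hY, by simpa, by simp; omega⟩⟩
    (DerivesDim.labelledRun hA (Derives.derivesDim hA h) hY (by simp) (by simpa using hK))

theorem labelledRun_descend (hA : A.Bounded b) (hK : (b + 1) ^ 3 + 1 ≤ K) {p r r' : ℕ} {m : Vec}
    (hp : p ≤ b) (h : (levelGrammar A b).Derives (0, r', r) m) :
    LabelledRun (BoundedStep A b K) ((0, p, r), []) [] m ((0, p, r'), []) := by
  have hX := Derives.le hA h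
  have hY : Item.Le (0, p, r') b := ⟨hX.1, hp, hX.2.1⟩
  rw [← zero_add m]
  exact .cons_nil ⟨.descend _ _ _, ⟨⟨hX.1, hp, hX.2.2⟩, by simp, by simp⟩,
    ⟨hY, by simpa, by simp; omega⟩⟩
    (DerivesDim.labelledRun hA (Derives.derivesDim hA h) hY (by simp) (by simpa using hK))

theorem labelledRun_of_ascent_descent (hA : A.Bounded b) (hK : (b + 1) ^ 3 + 1 ≤ K)
    {p q s r : ℕ} {v : List ℕ} {m m' : Vec} (hr : r ≤ b) (h : Ascent A b p v q m)
    (h' : Descent A b r s v m') :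
    LabelledRun (BoundedStep A b K) ((0, p, r), []) v.reverse (m + m') ((0, q, s), []) := by
  induction v generalizing q s m m' with
  | nil =>
    exact (labelledRun_ascend hA hK hr h).trans (labelledRun_descend hA hK (h.le hA) h')
  | cons γ v ih =>
    obtain ⟨s₁, s₂, m₁, n, m₂, h₁, he, h₂, rfl⟩ := h
    obtain ⟨r₁, r₂, k₁, l, k₂, h₁', he', h₂', rfl⟩ := h'
    have hγ := hA.symb _ _ _ _ _ he
    have hs₁ := hA.src _ _ _ _ he
    have hs₂ := hA.tgt _ _ _ _ he
    have hr₁ := hA.src _ _ _ _ he'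
    have hr₂ := hA.tgt _ _ _ _ he'
    have bounded {o x y : ℕ} (ho : o ≤ b) (hx : x ≤ b) (hy : y ≤ b) :
        CState.Le ((o, x, y), []) b K := ⟨⟨ho, hx, hy⟩, by simp, by simp⟩
    have run := (ih h₁ h₂').trans <| .head (T := BoundedStep A b K)
      ⟨.push _ he, bounded (by simp) hs₁ hr₂, bounded hγ hs₂ hr₂⟩ <| .cons_nil
      ⟨.pop _ he', bounded hγ hs₂ hr₂, bounded (by simp) hs₂ hr₁⟩ <|
      (labelledRun_ascend hA hK hr₁ h₂).trans
        (labelledRun_descend hA hK (Derives.le hA h₂).2.2 h₁')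
    convert run using 1
    · simp
    · abel

theorem exists_labelledRun_of_mem_SSet (hA : A.Bounded b) (hK : (b + 1) ^ 3 + 1 ≤ K) {q : ℕ}
    {w : List ℕ} {m : Vec} (h : (w, m) ∈ SSet A q) :
    LabelledRun (BoundedStep A b K) ((0, A.q0, A.qf), []) w m ((0, q, q), []) := by
  obtain ⟨m', h₁, h₂⟩ := h
  obtain ⟨k₁, hk₁, h₁⟩ := PReach.ascent hA hA.q0 h₁
  obtain ⟨k₂, hk₂, h₂⟩ := PReach.descent hA hA.qf h₂
  dsimp only at *
  subst h₁ h₂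
  simpa using labelledRun_of_ascent_descent hA hK hA.qf hk₁ hk₂

end Completeness

/-! ### Codes of multisets and vectors -/

section Codes

open Encodable

theorem exists_list_encode_eq {α : Type*} [Encodable α] (s : Multiset α) :
    ∃ l : List α, (l : Multiset α) = s ∧ encode s = encode l ∧
      l.Pairwise (encode · ≤ encode ·) := by
  refine ⟨_, ?_, rfl, ?_⟩
  · exact @Multiset.sort_eq _ s (_) (_) (_) (_) (_)
  · exact @Multiset.pairwise_sort _ s (_) (_) (_) (_) (_)
theorem encode_multiset_eq {α : Type*} [Encodable α] {s : Multiset α} {l : List α}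
    (hs : (l : Multiset α) = s) (hl : l.Pairwise (encode · ≤ encode ·)) :
    encode s = encode l := by
  obtain ⟨l', hs', h, hl'⟩ := exists_list_encode_eq s
  rw [h]
  refine congrArg encode (List.Perm.eq_of_pairwise
    (fun _ _ _ _ h h' => encode_injective (h.antisymm h')) hl' hl ?_)
  exact Multiset.coe_eq_coe.1 (hs'.trans hs.symm)

theorem encode_list_map {α β : Type*} [Encodable α] [Encodable β] {g : α → β}
    (hg : ∀ x, encode (g x) = encode x) (l : List α) : encode (l.map g) = encode l := by
  induction l with
  | nil => rfl
  | cons x l ih => simp [hg, ih]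

theorem encode_le_of_mem {α : Type*} [Encodable α] {x : α} {l : List α} (h : x ∈ l) :
    encode x ≤ encode l := by
  induction h with
  | head l => exact (Nat.left_le_pair _ _).trans (Nat.le_succ _)
  | tail y _ ih => exact ih.trans ((Nat.right_le_pair _ _).trans (Nat.le_succ _))

theorem encodeVec_zero : encodeVec 0 = 0 := by
  rw [encodeVec, Finsupp.graph_zero]
  exact encode_multiset_eq (l := []) rfl .nil

theorem encodeVec_injective : Function.Injective encodeVec := fun _ _ h =>
  Finsupp.graph_injective _ _ (Finset.val_injective (encode_injective h))

theorem pair_le_pair {a a' b b' : ℕ} (h : a ≤ a') (h' : b ≤ b') :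
    Nat.pair a b ≤ Nat.pair a' b' :=
  (StrictMono.monotone (f := (Nat.pair · b)) (fun _ _ => Nat.pair_lt_pair_left b) h).trans
    (StrictMono.monotone (f := Nat.pair a') (fun _ _ => Nat.pair_lt_pair_right a') h')

/-- A bound for the codes of lists of length at most `k` with elements of code at most `M`. -/
def listBound (M k : ℕ) : ℕ := (fun c => (Nat.pair M c).succ)^[k] 0

theorem encode_list_le {α : Type*} [Encodable α] {M k : ℕ} {l : List α}
    (hl : ∀ x ∈ l, encode x ≤ M) (hk : l.length ≤ k) : encode l ≤ listBound M k := by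
  induction l generalizing k with
  | nil => exact Nat.zero_le _
  | cons x l ih =>
    obtain _ | k := k
    · simp at hk
    · rw [listBound, Function.iterate_succ_apply', encode_list_cons]
      exact Nat.succ_le_succ (pair_le_pair (hl x (by simp))
        (ih (fun y hy => hl y (by simp [hy])) (by simpa using hk)))

theorem primrec_listBound {α : Type*} [Primcodable α] {f g : α → ℕ} (hf : Primrec f)
    (hg : Primrec g) : Primrec fun a => listBound (f a) (g a) :=
  .nat_iterate hg (.const 0)
    (Primrec.succ.comp (Primrec₂.natPair.comp (hf.comp .fst) .snd)).to₂

/-- An edge of a pushdown automaton with output, with the action and the vector replaced by their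
codes. -/
abbrev PEdgeCode : Type := ℕ × ℕ × ℕ × ℕ

/-- A pushdown automaton with output, with vectors and sets replaced by their codes. -/
abbrev PCode : Type := ℕ × ℕ × ℕ × List PEdgeCode × ℕ × ℕ

/-- `c` is a code of `A`. -/
structure PCode.Represents (c : PCode) (A : PDAO) : Prop where
  mem_edges : ∀ e, e ∈ c.2.2.2.1 ↔
    ∃ p l n p', (p, l, n, p') ∈ A.edges ∧ e = (p, encode l, encodeVec n, p')
  q0 : c.2.2.2.2.1 = A.q0
  qf : c.2.2.2.2.2 = A.qf

theorem exists_represents (A : PDAO) : ∃ c : PCode, c.Represents A ∧ encodePDAO A = encode c := by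
  obtain ⟨l, hl, h, -⟩ := exists_list_encode_eq
    (A.edges.val.map fun e => (e.1, encode e.2.1, encodeVec e.2.2.1, e.2.2.2))
  refine ⟨(encode A.states.val, encode A.alph.val, encode A.out.val, l, A.q0, A.qf),
    ⟨fun e => ?_, rfl, rfl⟩, ?_⟩
  · rw [← Multiset.mem_coe, hl]
    simp only [Multiset.mem_map, Finset.mem_val, Prod.exists, eq_comm]
  · simp only [encodePDAO, encode_prod_val, h, encode_nat]

theorem PCode.Represents.bounded {c : PCode} {A : PDAO} (h : c.Represents A) {b : ℕ}
    (hb : encode c ≤ b) : A.Bounded b := by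
  obtain ⟨x, y, z, E, q0, qf⟩ := c
  simp only [encode_prod_val, encode_nat] at hb
  have hb : Nat.pair (encode E) (Nat.pair q0 qf) ≤ b :=
    (Nat.right_le_pair _ _).trans ((Nat.right_le_pair _ _).trans ((Nat.right_le_pair _ _).trans hb))
  have hq : Nat.pair q0 qf ≤ b := (Nat.right_le_pair _ _).trans hb
  have hE {p l n p'} (he : (p, l, n, p') ∈ A.edges) :
      Nat.pair p (Nat.pair (encode l) (Nat.pair (encodeVec n) p')) ≤ b :=
    (encode_le_of_mem ((h.mem_edges _).2 ⟨p, l, n, p', he, rfl⟩)).trans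
      ((Nat.left_le_pair _ _).trans hb)
  have hl {p l n p'} (he : (p, l, n, p') ∈ A.edges) :
      Nat.pair (encode l) (Nat.pair (encodeVec n) p') ≤ b := (Nat.right_le_pair _ _).trans (hE he)
  have hn {p l n p'} (he : (p, l, n, p') ∈ A.edges) : Nat.pair (encodeVec n) p' ≤ b :=
    (Nat.right_le_pair _ _).trans (hl he)
  exact
    { q0 := h.q0 ▸ (Nat.left_le_pair _ _).trans hq
      qf := h.qf ▸ (Nat.right_le_pair _ _).trans hq
      src := fun _ _ _ _ he => (Nat.left_le_pair _ _).trans (hE he)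
      tgt := fun _ _ _ _ he => (Nat.right_le_pair _ _).trans (hn he)
      vec := fun _ _ _ _ he => (Nat.left_le_pair _ _).trans (hn he)
      symb := fun _ _ _ _ _ he => (Nat.succ_le_succ (Nat.right_le_pair _ _)).trans
        ((Nat.left_le_pair _ _).trans (hl he)) }

end Codes

/-! ### Computability of the transition relation -/

section Computability

open Encodable

/-- A transition of the automaton, with the vector replaced by its code. -/
abbrev CEdge : Type := CState × List ℕ × ℕ × CState

/-- `y` is a transition that does not use an edge of the pushdown automaton. -/
def SilentCode (y : CEdge) : Prop :=
  y = (((0, y.1.1.2.1, y.1.1.2.2), []), [], 0,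
    ((0, y.2.2.2.1.2.1, y.1.1.2.2), [(0, y.1.1.2.1, y.2.2.2.1.2.1)])) ∨
  y = (((0, y.1.1.2.1, y.1.1.2.2), []), [], 0,
    ((0, y.1.1.2.1, y.2.2.2.1.2.2), [(0, y.2.2.2.1.2.2, y.1.1.2.2)])) ∨
  y = ((y.1.1, (0, y.1.2.headI.2.1, y.1.2.headI.2.1) :: y.1.2.tail), [], 0,
    (y.1.1, y.1.2.tail))

/-- `y` is a transition that uses the edge with code `e` of the pushdown automaton. -/
def EdgeStepCode (e : PEdgeCode) (y : CEdge) : Prop :=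
  (e.2.1 = encode (some (false, y.2.2.2.1.1.pred)) ∧
    y = (((0, e.1, y.1.1.2.2), []), [y.2.2.2.1.1.pred], e.2.2.1,
      ((y.2.2.2.1.1.pred.succ, e.2.2.2, y.1.1.2.2), []))) ∨
  (e.2.1 = encode (some (true, y.1.1.1.pred)) ∧
    y = (((y.1.1.1.pred.succ, y.1.1.2.1, e.2.2.2), []), [], e.2.2.1,
      ((0, y.1.1.2.1, e.1), []))) ∨
  (e.2.1 = encode (none : PLabel) ∧
    y = ((y.1.1, (0, e.1, y.1.2.headI.2.2) :: y.1.2.tail), [], e.2.2.1,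
      (y.1.1, (0, e.2.2.2, y.1.2.headI.2.2) :: y.1.2.tail))) ∨
  (e.2.1 = encode (some (false, y.2.2.2.2.headI.1.pred)) ∧
    y = ((y.1.1, (0, e.1, y.1.2.headI.2.2) :: y.1.2.tail), [], e.2.2.1,
      (y.1.1, (y.2.2.2.2.headI.1.pred.succ, e.2.2.2, y.1.2.headI.2.2) :: y.1.2.tail))) ∨
  (e.2.1 = encode (some (true, y.1.2.headI.1.pred)) ∧
    y = ((y.1.1, (y.1.2.headI.1.pred.succ, y.1.2.headI.2.1, y.1.2.headI.2.2) :: y.1.2.tail), [],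
      e.2.2.1, (y.1.1, (0, y.1.2.headI.2.1, e.1) :: (0, e.2.2.2, y.1.2.headI.2.2) ::
        y.1.2.tail))) ∨
  (e.2.1 = encode (some (true, y.1.2.headI.1.pred)) ∧
    y = ((y.1.1, (y.1.2.headI.1.pred.succ, y.1.2.headI.2.1, y.1.2.headI.2.2) :: y.1.2.tail), [],
      e.2.2.1, (y.1.1, (0, e.2.2.2, y.1.2.headI.2.2) :: (0, y.1.2.headI.2.1, e.1) ::
        y.1.2.tail)))

/-- `y` is a transition of the automaton for a pushdown automaton with edge codes `E`. -/
def StepCode (E : List PEdgeCode) (y : CEdge) : Prop :=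
  SilentCode y ∨ ∃ e ∈ E, EdgeStepCode e y

theorem stepCode_iff {A : PDAO} {c : PCode} (hc : c.Represents A) (y : CEdge) :
    StepCode c.2.2.2.1 y ↔ ∃ s u n t, CStep A s u n t ∧ y = (s, u, encodeVec n, t) := by
  constructor
  · rintro ((h | h | h) | ⟨e, he, h⟩)
    · exact ⟨_, _, _, _, .ascend _ _ _, by rw [encodeVec_zero]; exact h⟩
    · exact ⟨_, _, _, _, .descend _ _ _, by rw [encodeVec_zero]; exact h⟩
    · exact ⟨_, _, _, _, .nil _ _ _, by rw [encodeVec_zero]; exact h⟩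
    · obtain ⟨p, l, n, p', he', rfl⟩ := (hc.mem_edges _).1 he
      rcases h with ⟨hl, h⟩ | ⟨hl, h⟩ | ⟨hl, h⟩ | ⟨hl, h⟩ | ⟨hl, h⟩ | ⟨hl, h⟩ <;>
        obtain rfl : l = _ := encode_injective hl
      · exact ⟨_, _, _, _, .push _ he', h⟩
      · exact ⟨_, _, _, _, .pop _ he', h⟩
      · exact ⟨_, _, _, _, .eps _ _ _ he', h⟩
      · exact ⟨_, _, _, _, .call _ _ _ he', h⟩
      · exact ⟨_, _, _, _, .retLeft _ _ _ _ he', h⟩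
      · exact ⟨_, _, _, _, .retRight _ _ _ _ he', h⟩
  · rintro ⟨s, u, n, t, h, rfl⟩
    have edge {p l n p'} (he : (p, l, n, p') ∈ A.edges) {y : CEdge}
        (h : EdgeStepCode (p, encode l, encodeVec n, p') y) : StepCode c.2.2.2.1 y :=
      .inr ⟨_, (hc.mem_edges _).2 ⟨_, _, _, _, he, rfl⟩, h⟩
    cases h with
    | ascend => exact .inl (.inl (by simp [encodeVec_zero]))
    | descend => exact .inl (.inr (.inl (by simp [encodeVec_zero])))
    | nil => exact .inl (.inr (.inr (by simp [encodeVec_zero])))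
    | push _ he => exact edge he (.inl ⟨rfl, rfl⟩)
    | pop _ he => exact edge he (.inr (.inl ⟨rfl, rfl⟩))
    | eps _ _ _ he => exact edge he (.inr (.inr (.inl ⟨rfl, rfl⟩)))
    | call _ _ _ he => exact edge he (.inr (.inr (.inr (.inl ⟨rfl, rfl⟩))))
    | retLeft _ _ _ _ he => exact edge he (.inr (.inr (.inr (.inr (.inl ⟨rfl, rfl⟩)))))
    | retRight _ _ _ _ he => exact edge he (.inr (.inr (.inr (.inr (.inr ⟨rfl, rfl⟩)))))

theorem primrecPred_silentCode : PrimrecPred SilentCode := by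
  have hX : Primrec fun y : CEdge => y.1.1 := .comp .fst .fst
  have hp : Primrec fun y : CEdge => y.1.1.2.1 := .comp .fst (.comp .snd hX)
  have hr : Primrec fun y : CEdge => y.1.1.2.2 := .comp .snd (.comp .snd hX)
  have hY : Primrec fun y : CEdge => y.2.2.2.1 :=
    .comp .fst (.comp .snd (.comp .snd .snd))
  have hp' : Primrec fun y : CEdge => y.2.2.2.1.2.1 := .comp .fst (.comp .snd hY)
  have hr' : Primrec fun y : CEdge => y.2.2.2.1.2.2 := .comp .snd (.comp .snd hY)
  have hL : Primrec fun y : CEdge => y.1.2 := .comp .snd .fst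
  have hh : Primrec fun y : CEdge => y.1.2.headI.2.1 :=
    .comp .fst (.comp .snd (Primrec.list_headI.comp hL))
  have ht : Primrec fun y : CEdge => y.1.2.tail := Primrec.list_tail.comp hL
  have nil : Primrec fun _ : CEdge => ([] : List Item) := .const []
  have item0 {f g : CEdge → ℕ} {l : CEdge → List Item} (hf : Primrec f) (hg : Primrec g)
      (hl : Primrec l) : Primrec fun y => (((0, f y, g y), l y) : CState) :=
    .pair (.pair (.const 0) (.pair hf hg)) hl
  exact .or (Primrec.eq.comp .id (.pair (item0 hp hr nil) (.pair (.const []) (.pair (.const 0)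
      (item0 hp' hr (Primrec.list_cons.comp (.pair (.const 0) (.pair hp hp')) nil)))))) <|
    .or (Primrec.eq.comp .id (.pair (item0 hp hr nil) (.pair (.const []) (.pair (.const 0)
      (item0 hp hr' (Primrec.list_cons.comp (.pair (.const 0) (.pair hr' hr)) nil)))))) <|
    Primrec.eq.comp .id (.pair (.pair hX
      (Primrec.list_cons.comp (.pair (.const 0) (.pair hh hh)) ht))
      (.pair (.const []) (.pair (.const 0) (.pair hX ht))))

theorem primrecRel_edgeStepCode : PrimrecRel EdgeStepCode := by
  have h₁ : Primrec fun x : PEdgeCode × CEdge => x.1.1 := .comp .fst .fst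
  have h₂ : Primrec fun x : PEdgeCode × CEdge => x.1.2.1 := .comp .fst (.comp .snd .fst)
  have h₃ : Primrec fun x : PEdgeCode × CEdge => x.1.2.2.1 :=
    .comp .fst (.comp .snd (.comp .snd .fst))
  have h₄ : Primrec fun x : PEdgeCode × CEdge => x.1.2.2.2 :=
    .comp .snd (.comp .snd (.comp .snd .fst))
  have hX : Primrec fun x : PEdgeCode × CEdge => x.2.1.1 := .comp .fst (.comp .fst .snd)
  have hγ : Primrec fun x : PEdgeCode × CEdge => x.2.1.1.1.pred :=
    Primrec.pred.comp (.comp .fst hX)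
  have hp : Primrec fun x : PEdgeCode × CEdge => x.2.1.1.2.1 := .comp .fst (.comp .snd hX)
  have hr : Primrec fun x : PEdgeCode × CEdge => x.2.1.1.2.2 := .comp .snd (.comp .snd hX)
  have ht : Primrec fun x : PEdgeCode × CEdge => x.2.2.2.2 :=
    .comp .snd (.comp .snd (.comp .snd .snd))
  have hγ' : Primrec fun x : PEdgeCode × CEdge => x.2.2.2.2.1.1.pred :=
    Primrec.pred.comp (.comp .fst (.comp .fst ht))
  have hL : Primrec fun x : PEdgeCode × CEdge => x.2.1.2 := .comp .snd (.comp .fst .snd)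
  have hZ : Primrec fun x : PEdgeCode × CEdge => x.2.1.2.headI :=
    Primrec.list_headI.comp hL
  have hZγ : Primrec fun x : PEdgeCode × CEdge => x.2.1.2.headI.1.pred :=
    Primrec.pred.comp (.comp .fst hZ)
  have hZp : Primrec fun x : PEdgeCode × CEdge => x.2.1.2.headI.2.1 :=
    .comp .fst (.comp .snd hZ)
  have hZr : Primrec fun x : PEdgeCode × CEdge => x.2.1.2.headI.2.2 :=
    .comp .snd (.comp .snd hZ)
  have htail : Primrec fun x : PEdgeCode × CEdge => x.2.1.2.tail :=
    Primrec.list_tail.comp hL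
  have hZ' : Primrec fun x : PEdgeCode × CEdge => x.2.2.2.2.2.headI.1.pred :=
    Primrec.pred.comp (.comp .fst (Primrec.list_headI.comp (.comp .snd ht)))
  have label (z : Bool) {g : PEdgeCode × CEdge → ℕ} (hg : Primrec g) :
      Primrec fun x => encode (some (z, g x)) :=
    Primrec.encode.comp (Primrec.option_some.comp (.pair (.const z) hg))
  have nil : Primrec fun _ : PEdgeCode × CEdge => ([] : List Item) := .const []
  have state {X : PEdgeCode × CEdge → Item} {L : PEdgeCode × CEdge → List Item}
      (hX : Primrec X) (hL : Primrec L) : Primrec fun x => ((X x, L x) : CState) := .pair hX hL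
  have item {i f g : PEdgeCode × CEdge → ℕ} (hi : Primrec i) (hf : Primrec f)
      (hg : Primrec g) : Primrec fun x => ((i x, f x, g x) : Item) := .pair hi (.pair hf hg)
  have cons {X : PEdgeCode × CEdge → Item} {L : PEdgeCode × CEdge → List Item}
      (hX : Primrec X) (hL : Primrec L) : Primrec fun x => X x :: L x :=
    Primrec.list_cons.comp hX hL
  have edge {s t : PEdgeCode × CEdge → CState} {u : PEdgeCode × CEdge → List ℕ}
      {l : PEdgeCode × CEdge → ℕ} (hl : Primrec l) (hs : Primrec s) (hu : Primrec u)
      (ht : Primrec t) :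
      PrimrecPred fun x => x.1.2.1 = l x ∧ x.2 = (s x, u x, x.1.2.2.1, t x) :=
    .and (Primrec.eq.comp h₂ hl) (Primrec.eq.comp .snd (.pair hs (.pair hu (.pair h₃ ht))))
  have hzero : Primrec fun _ : PEdgeCode × CEdge => 0 := .const 0
  have succ {f : PEdgeCode × CEdge → ℕ} (hf : Primrec f) :
      Primrec fun x => (f x).succ := Primrec.succ.comp hf
  have eps : Primrec fun _ : PEdgeCode × CEdge => ([] : List ℕ) := .const []
  have hleft := item hzero hZp h₁
  have hright := item hzero h₄ hZr
  have ret := state hX (cons (item (succ hZγ) hZp hZr) htail)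
  exact .or (edge (label _ hγ') (state (item hzero h₁ hr) nil)
      (Primrec.list_cons.comp hγ' eps) (state (item (succ hγ') h₄ hr) nil)) <|
    .or (edge (label _ hγ) (state (item (succ hγ) hp h₄) nil) eps
      (state (item hzero hp h₁) nil)) <|
    .or (edge (.const _) (state hX (cons (item hzero h₁ hZr) htail)) eps
      (state hX (cons hright htail))) <|
    .or (edge (label _ hZ') (state hX (cons (item hzero h₁ hZr) htail)) eps
      (state hX (cons (item (succ hZ') h₄ hZr) htail))) <|
    .or (edge (label _ hZγ) ret eps (state hX (cons hleft (cons hright htail)))) <|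
    edge (label _ hZγ) ret eps (state hX (cons hright (cons hleft htail)))

theorem primrecRel_stepCode : PrimrecRel StepCode :=
  .or (primrecPred_silentCode.comp .snd) (primrecRel_edgeStepCode.exists_mem_list)

open Classical in
/-- The transitions with code less than `N`. -/
def stepList (N : ℕ) (E : List PEdgeCode) : List CEdge :=
  ((List.range N).map (Denumerable.ofNat CEdge)).filter (StepCode E ·)

theorem mem_stepList {N : ℕ} {E : List PEdgeCode} {y : CEdge} :
    y ∈ stepList N E ↔ encode y < N ∧ StepCode E y := by
  simp only [stepList, List.mem_filter, List.mem_map, List.mem_range, decide_eq_true_eq]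
  refine and_congr_left fun _ => ⟨?_, fun h => ⟨_, h, Denumerable.ofNat_encode y⟩⟩
  rintro ⟨x, hx, rfl⟩
  rwa [Denumerable.encode_ofNat]

theorem pairwise_stepList (N : ℕ) (E : List PEdgeCode) :
    (stepList N E).Pairwise (encode · < encode ·) := by
  refine .filter _ (List.pairwise_map.2 ?_)
  simpa only [Denumerable.encode_ofNat] using List.pairwise_lt_range

theorem primrec_stepList {α : Type*} [Primcodable α] {f : α → ℕ}
    {g : α → List PEdgeCode} (hf : Primrec f) (hg : Primrec g) :
    Primrec fun a => stepList (f a) (g a) := by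
  classical
  have hR : PrimrecRel fun (y : CEdge) (E : List PEdgeCode) => StepCode E y :=
    primrecRel_stepCode.comp .snd .fst
  refine (hR.listFilter.comp (.list_map (Primrec.list_range.comp hf)
    ((Primrec.ofNat CEdge).comp₂ .right)) hg).of_eq fun a => ?_
  unfold stepList
  congr!

/-- A bound for the codes of items with components at most `b`. -/
def itemBound (b : ℕ) : ℕ := Nat.pair b (Nat.pair b b)

/-- A bound for the codes of states. -/
def stateBound (b : ℕ) : ℕ :=
  Nat.pair (itemBound b) (listBound (itemBound b) ((b + 1) * (b + 1) * (b + 1) + 1))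

/-- A bound for the codes of transitions. -/
def edgeBound (b : ℕ) : ℕ :=
  Nat.pair (stateBound b) (Nat.pair (listBound b 1) (Nat.pair b (stateBound b)))

theorem Item.Le.encode_le {X : Item} {b : ℕ} (h : X.Le b) : encode X ≤ itemBound b :=
  pair_le_pair h.1 (pair_le_pair h.2.1 h.2.2)

theorem CState.Le.encode_le {s : CState} {b : ℕ}
    (h : s.Le b ((b + 1) * (b + 1) * (b + 1) + 1)) : encode s ≤ stateBound b :=
  pair_le_pair h.1.encode_le (encode_list_le (fun X hX => (h.2.1 X hX).encode_le) h.2.2)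

theorem BoundedStep.encode_le {A : PDAO} {b : ℕ} (hA : A.Bounded b) {s t : CState} {u : List ℕ}
    {n : Vec} (h : BoundedStep A b ((b + 1) * (b + 1) * (b + 1) + 1) s u n t) :
    encode (s, u, encodeVec n, t) ≤ edgeBound b := by
  obtain ⟨h, hs, ht⟩ := h
  refine pair_le_pair hs.encode_le (pair_le_pair ?_ (pair_le_pair ?_ ht.encode_le))
  · change encode u ≤ _
    refine encode_list_le (fun γ hγ => ?_) ?_
    · cases h <;> simp only [List.mem_singleton, List.not_mem_nil] at hγ
      next he => exact hγ ▸ Nat.le_of_succ_le (hA.symb _ _ _ _ _ he)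
    · cases h <;> simp
  · cases h <;> first
      | exact encodeVec_zero.trans_le (Nat.zero_le b)
      | exact hA.vec _ _ _ _ ‹_›

theorem primrec_edgeBound : Primrec edgeBound := by
  have hs : Primrec fun b : ℕ => b + 1 := .succ
  have hI : Primrec itemBound :=
    Primrec₂.natPair.comp .id (Primrec₂.natPair.comp .id .id)
  have hS : Primrec stateBound :=
    Primrec₂.natPair.comp hI (primrec_listBound hI
      (Primrec.succ.comp (Primrec.nat_mul.comp (Primrec.nat_mul.comp hs hs) hs)))
  exact Primrec₂.natPair.comp hS (Primrec₂.natPair.comp (primrec_listBound .id (.const 1))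
    (Primrec₂.natPair.comp .id hS))

/-- The code of the automaton for the pushdown automaton with code `x.1` and the state `x.2`. -/
def autCode (x : PCode × ℕ) : List ℕ × List CEdge × CState × List CState :=
  (List.range (edgeBound (encode x) + 1),
    stepList (edgeBound (encode x) + 1) x.1.2.2.2.1,
    ((0, x.1.2.2.2.2.1, x.1.2.2.2.2.2), []), [((0, x.2, x.2), [])])

theorem primrec_autCode : Primrec autCode := by
  have hN : Primrec fun x : PCode × ℕ => edgeBound (encode x) + 1 :=
    Primrec.succ.comp (primrec_edgeBound.comp .encode)
  have hE : Primrec fun x : PCode × ℕ => x.1.2.2.2 := .comp .snd (.comp .snd (.comp .snd .fst))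
  have state {f g : PCode × ℕ → ℕ} (hf : Primrec f) (hg : Primrec g) :
      Primrec fun x => (((0, f x, g x), []) : CState) :=
    .pair (.pair (.const 0) (.pair hf hg)) (.const [])
  have hl : Primrec fun x : PCode × ℕ => stepList (edgeBound (encode x) + 1) x.1.2.2.2.1 :=
    primrec_stepList hN (.comp .fst hE)
  have hq : Primrec fun x : PCode × ℕ => x.1.2.2.2.2 := .comp .snd hE
  have hs := state (.comp .fst hq) (.comp .snd hq)
  have ht := Primrec.list_cons.comp (state .snd .snd) (.const [])
  exact .pair (Primrec.list_range.comp hN) (.pair hl (.pair hs ht))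

end Computability

/-! ### The automaton as a `RatAut` -/

section RatAut

open Encodable

theorem exists_ratAut (N : ℕ) {l : List CEdge} (s₀ t₀ : CState)
    (hl : l.Pairwise (encode · < encode ·)) (hvec : ∀ y ∈ l, y.2.2.1 ∈ Set.range encodeVec) :
    ∃ B : RatAut, encode (List.range N, l, s₀, [t₀]) = encodeRatAut B ∧ B.q0 = encode s₀ ∧
      B.final = {encode t₀} ∧ ∀ e, e ∈ B.edges ↔ ∃ s t, e.1 = encode s ∧ e.2.2 = encode t ∧
        (s, e.2.1.1, encodeVec e.2.1.2, t) ∈ l := by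
  let g (e : ℕ × (List ℕ × Vec) × ℕ) : ℕ × List ℕ × ℕ × ℕ :=
    (e.1, e.2.1.1, encodeVec e.2.1.2, e.2.2)
  have hg : Function.Injective g := by
    rintro ⟨s, ⟨u, n⟩, t⟩ ⟨s', ⟨u', n'⟩, t'⟩ h
    simp only [g, Prod.mk.injEq] at h
    obtain ⟨rfl, rfl, h, rfl⟩ := h
    rw [encodeVec_injective h]
  let k (y : CEdge) : ℕ × List ℕ × ℕ × ℕ := (encode y.1, y.2.1, y.2.2.1, encode y.2.2.2)
  have hk (y : CEdge) : encode (k y) = encode y := rfl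
  have hkl : (l.map k).Pairwise (encode · < encode ·) := by
    simpa only [List.pairwise_map, hk] using hl
  have mem_kl (e) : g e ∈ l.map k ↔ ∃ s t, e.1 = encode s ∧ e.2.2 = encode t ∧
      (s, e.2.1.1, encodeVec e.2.1.2, t) ∈ l := by
    rw [List.mem_map]
    constructor
    · rintro ⟨⟨s, u, v, t⟩, h, hgk⟩
      simp only [g, k, Prod.mk.injEq] at hgk
      obtain ⟨hs, rfl, rfl, ht⟩ := hgk
      exact ⟨s, t, hs.symm, ht.symm, h⟩
    · rintro ⟨s, t, hs, ht, h⟩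
      exact ⟨_, h, by simp only [g, k, hs, ht]⟩
  let B : RatAut := ⟨.range N, (l.map k).toFinset.preimage g hg.injOn, encode s₀, {encode t₀}⟩
  have mem_edges (e) : e ∈ B.edges ↔ g e ∈ l.map k := by
    simp only [B, Finset.mem_preimage, List.mem_toFinset]
  refine ⟨B, ?_, rfl, rfl, fun e => (mem_edges e).trans (mem_kl e)⟩
  have hstates : encode B.states.val = encode (List.range N) :=
    encode_multiset_eq rfl (List.pairwise_lt_range.imp le_of_lt)
  have hedges : encode (B.edges.val.map g) = encode (l.map k) := by
    refine encode_multiset_eq (Multiset.Nodup.ext ?_ ?_ |>.2 fun e => ?_) (hkl.imp le_of_lt)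
    · exact Multiset.coe_nodup.2 (hkl.imp fun h h' => h.ne (congrArg _ h'))
    · exact B.edges.nodup.map hg
    · rw [Multiset.mem_coe, Multiset.mem_map]
      constructor
      · intro h
        obtain ⟨y, hy, rfl⟩ := List.mem_map.1 h
        obtain ⟨n, hn⟩ := hvec y hy
        have hgy : g (encode y.1, (y.2.1, n), encode y.2.2.2) = k y := by simp only [g, k, hn]
        exact ⟨_, (mem_edges _).2 (hgy ▸ h), hgy⟩
      · rintro ⟨e, he, rfl⟩
        exact (mem_edges e).1 he
  have hfinal : encode B.final.val = encode [t₀] :=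
    (encode_multiset_eq (l := [encode t₀]) rfl (List.pairwise_singleton _ _)).trans rfl
  change _ = encode (B.states.val, B.edges.val.map g, encode s₀, B.final.val)
  simp only [encode_prod_val, hstates, hedges, hfinal, encode_list_map hk, encode_nat]

variable {B : RatAut} {T : CState → List ℕ → Vec → CState → Prop}

theorem reflTransGen_rStep_iff (hB : ∀ e, e ∈ B.edges ↔
      ∃ s t, e.1 = encode s ∧ e.2.2 = encode t ∧ T s e.2.1.1 e.2.1.2 t)
    {s t : CState} {u u' : List ℕ} {n n' : Vec} :
    Relation.ReflTransGen (RStep B) (encode s, u, n) (encode t, u', n') ↔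
      ∃ v m, LabelledRun T s v m t ∧ u' = u ++ v ∧ n' = n + m := by
  constructor
  · intro h
    generalize hx : (encode s, u, n) = x at h
    induction h using Relation.ReflTransGen.head_induction_on generalizing s u n with
    | refl =>
      simp only [Prod.mk.injEq] at hx
      obtain ⟨hs, rfl, rfl⟩ := hx
      obtain rfl := encode_injective hs
      exact ⟨[], 0, .refl, by simp, by simp⟩
    | @head _ x h _ ih =>
      subst hx
      obtain ⟨e, he, h₁, h₂, h₃, h₄⟩ := h
      obtain ⟨s', t', hs, ht, hT⟩ := (hB e).1 he
      obtain rfl : s = s' := encode_injective (h₁.trans hs)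
      obtain ⟨v, m, run, rfl, rfl⟩ := ih (Prod.ext (h₂.trans ht).symm rfl)
      exact ⟨_, _, .head hT run, by simp [h₃], by simp [h₄, add_assoc]⟩
  · rintro ⟨v, m, h, rfl, rfl⟩
    induction h generalizing u n with
    | refl => simpa using .refl
    | head h _ ih =>
      rw [← List.append_assoc, ← add_assoc]
      exact .head ⟨(_, (_, _), _), (hB _).2 ⟨_, _, rfl, rfl, h⟩, rfl, rfl, rfl, rfl⟩ ih

theorem rLang_eq (hB : ∀ e, e ∈ B.edges ↔
      ∃ s t, e.1 = encode s ∧ e.2.2 = encode t ∧ T s e.2.1.1 e.2.1.2 t)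
    {s₀ t₀ : CState} (h₀ : B.q0 = encode s₀) (hf : B.final = {encode t₀}) :
    RLang B = {wm | LabelledRun T s₀ wm.1 wm.2 t₀} := by
  ext ⟨w, m⟩
  simp [RLang, h₀, hf, reflTransGen_rStep_iff hB]

end RatAut

/-- Given a pushdown automaton with output `A` and a state
`q` of `A`, the set `S_{A,q}` is rational, and an automaton recognizing it
can be effectively constructed from `A`. -/
theorem SSet_rational :
    ∃ f : ℕ → ℕ, Computable f ∧
      ∀ (A : PDAO) (q : ℕ), q ∈ A.states →
        ∃ B : RatAut,
          f (Nat.pair (encodePDAO A) q) = encodeRatAut B ∧ RLang B = SSet A q := by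
  refine ⟨fun n => Encodable.encode (autCode (Denumerable.ofNat (PCode × ℕ) n)),
    (Primrec.encode.comp (primrec_autCode.comp (Primrec.ofNat _))).to_comp, fun A q _ => ?_⟩
  obtain ⟨c, hc, h⟩ := exists_represents A
  have hcode : Nat.pair (encodePDAO A) q = Encodable.encode (c, q) := by
    rw [h, Encodable.encode_prod_val c q, Encodable.encode_nat]
  have hA : A.Bounded (Encodable.encode (c, q)) := hc.bounded (Nat.left_le_pair _ _)
  obtain ⟨B, hB, h₀, hf, hedges⟩ := exists_ratAut (edgeBound (Encodable.encode (c, q)) + 1)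
    ((0, A.q0, A.qf), []) ((0, q, q), [])
    (pairwise_stepList (edgeBound (Encodable.encode (c, q)) + 1) c.2.2.2.1) fun y hy => by
      obtain ⟨s, u, n, t, -, rfl⟩ := (stepCode_iff hc y).1 (mem_stepList.1 hy).2
      exact ⟨n, rfl⟩
  refine ⟨B, ?_, (rLang_eq (T := fun s u n t => (s, u, encodeVec n, t) ∈ stepList _ _)
    hedges h₀ hf).trans (Set.ext fun wm => ⟨fun h => ?_, fun h => ?_⟩)⟩
  · simp only [hcode, Denumerable.ofNat_encode, autCode, hc.q0, hc.qf, hB]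
  · refine mem_SSet_of_labelledRun (h.mono fun s u n t hT => ?_)
    obtain ⟨s', u', n', t', hT, heq⟩ := (stepCode_iff hc _).1 (mem_stepList.1 hT).2
    simp only [Prod.mk.injEq] at heq
    obtain ⟨rfl, rfl, hn, rfl⟩ := heq
    rwa [encodeVec_injective hn]
  · refine (exists_labelledRun_of_mem_SSet hA (K := _) (le_of_eq (by ring)) h).mono
      fun s u n t hT => mem_stepList.2 ⟨Nat.lt_succ_of_le (hT.encode_le hA),
        (stepCode_iff hc _).2 ⟨_, _, _, _, hT.1, rfl⟩⟩

end CBL
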